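/- The Jacobi triple product identity: Θ_q(z) = ∏_{n=0}^∞ (1 − q^{−n−1})(1 + q^{−n−1} z)(1 + q^{−n} z^{−1}) for all z ∈ ℂ*; consequently Θ_q vanishes exactly on the discrete q-spiral −q^ℤ, with simple zeros. -/

import Mathlib

open scoped BigOperators
noncomputable section

/-- The Jacobi theta function `Θ_q(z) = Σ_{n∈ℤ} q^{−n(n+1)/2} z^n`. -/
def Theta (q : ℝ) (z : ℂ) : ℂ := ∑' n : ℤ, (q : ℂ) ^ (-(n * (n + 1) / 2)) * z ^ n

open Filter Topology

def tT (n : ℤ) : ℤ := n * (n + 1) / 2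

lemma tT_two (n : ℤ) : 2 * tT n = n * (n + 1) :=
  Int.mul_ediv_cancel' (Int.even_mul_succ_self n).two_dvd

lemma tT_succ (n : ℤ) : tT (n + 1) = tT n + (n + 1) := by
  have h1 := tT_two n
  have h2 := tT_two (n + 1)
  have : 2 * tT (n + 1) = 2 * (tT n + (n + 1)) := by rw [h2, mul_add 2, h1]; ring
  omega

lemma tT_pred (n : ℤ) : tT (n - 1) = tT n - n := by
  have := tT_succ (n - 1)
  rw [sub_add_cancel] at this
  omega

/-- finite Pochhammer -/
def pP (x : ℝ) (n : ℕ) : ℝ := ∏ k ∈ Finset.range n, (1 - x ^ (k + 1))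

def rR (x : ℝ) (m : ℤ) : ℝ := if 0 ≤ m then (pP x m.toNat)⁻¹ else 0

lemma pP_succ (x : ℝ) (n : ℕ) : pP x (n + 1) = pP x n * (1 - x ^ (n + 1)) := by
  simp [pP, Finset.prod_range_succ]

lemma fac_pos {x : ℝ} (h0 : 0 < x) (h1 : x < 1) (n : ℕ) : 0 < 1 - x ^ (n + 1) := by
  have := pow_lt_one₀ h0.le h1 (Nat.succ_ne_zero n)
  simpa using this

lemma pP_pos {x : ℝ} (h0 : 0 < x) (h1 : x < 1) (n : ℕ) : 0 < pP x n :=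
  Finset.prod_pos fun k _ => fac_pos h0 h1 k

lemma pP_le_one {x : ℝ} (h0 : 0 < x) (h1 : x < 1) (n : ℕ) : pP x n ≤ 1 :=
  Finset.prod_le_one (fun k _ => (fac_pos h0 h1 k).le) fun k _ => by
    have := pow_pos h0 (k + 1)
    linarith

lemma rR_pred {x : ℝ} (h0 : 0 < x) (h1 : x < 1) (m : ℤ) :
    rR x (m - 1) = (1 - x ^ m) * rR x m := by
  rcases lt_trichotomy m 0 with h | h | h
  · simp only [rR, if_neg (show ¬ (0 ≤ m - 1) by omega), if_neg (show ¬ (0 ≤ m) by omega), mul_zero]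
  · subst h; simp [rR]
  · obtain ⟨k, rfl⟩ : ∃ k : ℕ, m = k + 1 := ⟨(m - 1).toNat, by omega⟩
    have e : ((k : ℤ) + 1).toNat = k + 1 := by omega
    have e2 : x ^ ((k : ℤ) + 1) = x ^ (k + 1) := by exact_mod_cast zpow_natCast x (k + 1)
    have := fac_pos h0 h1 k
    have := pP_pos h0 h1 k
    simp only [rR, add_sub_cancel_right, Int.natCast_nonneg, if_true, Int.toNat_natCast, e, e2, pP_succ,
      show (0 : ℤ) ≤ (k : ℤ) + 1 by omega]
    field_simp

/-- coefficient -/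
def cC (x : ℝ) (N : ℕ) (n : ℤ) : ℝ := pP x (2 * N) * rR x (N + n) * rR x (N - n) * x ^ tT n

lemma cC_succ {x : ℝ} (h0 : 0 < x) (h1 : x < 1) (N : ℕ) (n : ℤ) :
    cC x (N + 1) n = (1 + x ^ (2 * N + 1)) * cC x N n + x ^ (N + 1) * cC x N (n - 1)
      + x ^ N * cC x N (n + 1) := by
  have hx : x ≠ 0 := h0.ne'
  set a := rR x (N + 1 + n) with ha
  set b := rR x (N + 1 - n) with hb
  set u := x ^ ((N : ℤ) + 1 + n) with hu
  set v := x ^ ((N : ℤ) + 1 - n) with hv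
  have hu0 : u ≠ 0 := zpow_ne_zero _ hx
  have hv0 : v ≠ 0 := zpow_ne_zero _ hx
  have r1 : rR x (N + n) = (1 - u) * a := by
    rw [ha, hu, ← rR_pred h0 h1]; congr 1; ring
  have r2 : rR x (N - n) = (1 - v) * b := by
    rw [hb, hv, ← rR_pred h0 h1]; congr 1; ring
  have r3 : rR x (N + (n - 1)) = (1 - u / x) * ((1 - u) * a) := by
    rw [← r1, hu, div_eq_mul_inv, ← zpow_sub_one₀ hx, show (N : ℤ) + 1 + n - 1 = N + n by ring, ← rR_pred h0 h1]
    congr 1; ring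
  have r4 : rR x (N - (n + 1)) = (1 - v / x) * ((1 - v) * b) := by
    rw [← r2, hv, div_eq_mul_inv, ← zpow_sub_one₀ hx, show (N : ℤ) + 1 - n - 1 = N - n by ring, ← rR_pred h0 h1]
    congr 1; ring
  have r5 : rR x (N - (n - 1)) = b := by rw [hb]; congr 1; ring
  have r6 : rR x (N + (n + 1)) = a := by rw [ha]; congr 1; ring
  have huv : x ^ (2 * N + 2) = u * v := by
    rw [hu, hv, ← zpow_add₀ hx, ← zpow_natCast]; congr 1; push_cast; ring
  have huv1 : x ^ (2 * N + 1) = u * v / x := by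
    rw [← huv]; field_simp; ring
  have p : pP x (2 * (N + 1)) = pP x (2 * N) * (1 - u * v / x) * (1 - u * v) := by
    rw [show 2 * (N + 1) = 2 * N + 1 + 1 by ring, pP_succ, pP_succ, ← huv1, ← huv]
  have t1 : x ^ (N + 1) * x ^ tT (n - 1) = v * x ^ tT n := by
    rw [hv, tT_pred, ← zpow_natCast, ← zpow_add₀ hx, ← zpow_add₀ hx]; congr 1; push_cast; ring
  have t2 : x ^ N * x ^ tT (n + 1) = u * x ^ tT n := by
    rw [hu, tT_succ, ← zpow_natCast, ← zpow_add₀ hx, ← zpow_add₀ hx]; congr 1; push_cast; ring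
  unfold cC
  push_cast
  rw [r1, r2, r3, r4, r5, r6, p, ← ha, ← hb, huv1]
  have : ∀ A B C D E F : ℝ, x ^ (N + 1) * (A * B * C * x ^ tT (n - 1)) + x ^ N * (D * E * F * x ^ tT (n + 1))
    = A * B * C * (v * x ^ tT n) + D * E * F * (u * x ^ tT n) := by
    intros; rw [← t1, ← t2]; ring
  rw [add_assoc, this]
  field_simp
  ring

lemma cC_zero (x : ℝ) (n : ℤ) : cC x 0 n = if n = 0 then 1 else 0 := by
  split_ifs with h
  · subst h; simp [cC, rR, pP, tT]
  · rcases lt_or_gt_of_ne h with h | h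
    · simp [cC, rR, show ¬ (0 ≤ n) by omega]
    · simp [cC, rR, show ¬ (n ≤ 0) by omega]

def fF (x : ℝ) (N : ℕ) (z : ℂ) : ℂ :=
  ∏ k ∈ Finset.range N, ((1 + (x : ℂ) ^ (k + 1) * z) * (1 + (x : ℂ) ^ k * z⁻¹))

lemma hasSum_fF {x : ℝ} (h0 : 0 < x) (h1 : x < 1) (z : ℂ) (hz : z ≠ 0) (N : ℕ) :
    HasSum (fun n : ℤ => (cC x N n : ℂ) * z ^ n) (fF x N z) := by
  induction N with
  | zero =>
    convert hasSum_ite_eq (0 : ℤ) (1 : ℂ) using 2 with n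
    · rw [cC_zero]; split_ifs with h <;> simp [h]
    · simp [fF]
  | succ N ih =>
    have s1 := (ih.mul_left (1 + (x : ℂ) ^ (2 * N + 1)))
    have s2 := ((Equiv.subRight (1 : ℤ)).hasSum_iff.mpr ih).mul_left ((x : ℂ) ^ (N + 1) * z)
    have s3 := ((Equiv.addRight (1 : ℤ)).hasSum_iff.mpr ih).mul_left ((x : ℂ) ^ N * z⁻¹)
    have s4 := (s1.add s2).add s3
    have e1 : fF x (N + 1) z = (1 + (x : ℂ) ^ (2 * N + 1)) * fF x N z + (x : ℂ) ^ (N + 1) * z * fF x N z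
        + (x : ℂ) ^ N * z⁻¹ * fF x N z := by
      unfold fF
      rw [Finset.prod_range_succ]
      field_simp
      ring
    rw [e1]
    refine (congrArg (fun f => HasSum f _) (funext fun n => ?_)).mpr s4
    · rw [cC_succ h0 h1]
      simp only [Function.comp, Equiv.subRight_apply, Equiv.coe_addRight]
      rw [zpow_add_one₀ hz, zpow_sub_one₀ hz]
      push_cast
      field_simp

lemma pow_summable {x : ℝ} (h0 : 0 < x) (h1 : x < 1) : Summable fun n : ℕ => x ^ (n + 1) :=
  (summable_nat_add_iff 1).mpr (summable_geometric_of_lt_one h0.le h1)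

lemma pP_tendsto {x : ℝ} (h0 : 0 < x) (h1 : x < 1) :
    ∃ L : ℝ, 0 < L ∧ Tendsto (pP x) atTop (𝓝 L) ∧ ∀ n, L ≤ pP x n := by
  have hs : Summable fun n : ℕ => ‖-x ^ (n + 1)‖ := (pow_summable h0 h1).neg.norm
  have hm := multipliable_one_add_of_summable hs
  have hne := tprod_one_add_ne_zero_of_summable (f := fun n : ℕ => -x ^ (n + 1))
    (fun i => by have := fac_pos h0 h1 i; rw [← sub_eq_add_neg]; exact this.ne') hs
  have ht : Tendsto (pP x) atTop (𝓝 (∏' n : ℕ, (1 + -x ^ (n + 1)))) := by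
    have := hm.hasProd.tendsto_prod_nat
    refine this.congr fun n => ?_
    simp only [← sub_eq_add_neg, pP]
  have hanti : Antitone (pP x) := antitone_nat_of_succ_le fun n => by
    rw [pP_succ]
    have := pP_pos h0 h1 n
    have := pow_pos h0 (n + 1)
    nlinarith
  refine ⟨_, lt_of_le_of_ne ?_ hne.symm, ht, fun n => hanti.le_of_tendsto ht n⟩
  exact ge_of_tendsto' ht fun n => (pP_pos h0 h1 n).le

lemma theta_summable {x : ℝ} (h0 : 0 < x) (h1 : x < 1) {w : ℝ} (hw : 0 < w) :
    Summable fun n : ℤ => x ^ tT n * w ^ n := by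
  have hx : x ≠ 0 := h0.ne'
  have hw' : w ≠ 0 := hw.ne'
  have hp : Tendsto (fun n : ℕ => x ^ (n + 1)) atTop (𝓝 0) :=
    (tendsto_pow_atTop_nhds_zero_of_lt_one h0.le h1).comp (tendsto_add_atTop_nat 1)
  have hp' : Tendsto (fun n : ℕ => x ^ n) atTop (𝓝 0) :=
    (tendsto_pow_atTop_nhds_zero_of_lt_one h0.le h1)
  refine Summable.of_nat_of_neg ?_ ?_
  · refine summable_of_ratio_test_tendsto_lt_one (l := 0) one_pos
      (Eventually.of_forall fun n => by positivity) ?_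
    have := hp.mul_const w
    rw [zero_mul] at this
    refine this.congr fun n => ?_
    push_cast
    rw [tT_succ, zpow_add₀ hx, zpow_add_one₀ hw', Real.norm_of_nonneg (by positivity),
      Real.norm_of_nonneg (by positivity)]
    have : x ^ ((n : ℤ) + 1) = x ^ (n + 1) := by exact_mod_cast zpow_natCast x (n + 1)
    rw [this]
    field_simp
  · refine summable_of_ratio_test_tendsto_lt_one (l := 0) one_pos
      (Eventually.of_forall fun n => by positivity) ?_
    have := hp'.mul_const w⁻¹
    rw [zero_mul] at this
    refine this.congr fun n => ?_
    push_cast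
    rw [show -((n : ℤ) + 1) = -n - 1 by ring, tT_pred, zpow_sub₀ hx, zpow_sub_one₀ hw',
      Real.norm_of_nonneg (by positivity), Real.norm_of_nonneg (by positivity), zpow_neg x n, zpow_natCast]
    field_simp

lemma rR_nonneg {x : ℝ} (h0 : 0 < x) (h1 : x < 1) (m : ℤ) : 0 ≤ rR x m := by
  unfold rR
  have := pP_pos h0 h1 m.toNat
  split_ifs <;> positivity

lemma finite_tendsto {x : ℝ} (h0 : 0 < x) (h1 : x < 1) (z : ℂ) (hz : z ≠ 0) :
    Tendsto (fun N => (pP x N : ℂ) * fF x N z) atTop (𝓝 (∑' n : ℤ, (x : ℂ) ^ tT n * z ^ n)) := by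
  obtain ⟨L, hL, hlim, hle⟩ := pP_tendsto h0 h1
  have hr : ∀ m, rR x m ≤ L⁻¹ := fun m => by
    unfold rR
    split_ifs
    · exact inv_anti₀ hL (hle _)
    · positivity
  have hrt : ∀ g : ℕ → ℤ, Tendsto g atTop atTop → Tendsto (fun N => rR x (g N)) atTop (𝓝 L⁻¹) := by
    intro g hg
    have hT : Tendsto (fun N => (g N).toNat) atTop atTop := by
      refine tendsto_atTop.mpr fun b => ?_
      filter_upwards [hg.eventually_ge_atTop (b : ℤ)] with N hN
      omega
    refine ((hlim.comp hT).inv₀ hL.ne').congr' ?_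
    filter_upwards [hg.eventually_ge_atTop 0] with N hN
    simp [rR, hN]
  have e : ∀ N, (pP x N : ℂ) * fF x N z = ∑' n : ℤ, (pP x N : ℂ) * ((cC x N n : ℂ) * z ^ n) :=
    fun N => ((hasSum_fF h0 h1 z hz N).mul_left _).tsum_eq.symm
  simp_rw [e]
  have hw : 0 < ‖z‖ := norm_pos_iff.mpr hz
  refine tendsto_tsum_of_dominated_convergence
    (((theta_summable h0 h1 hw).mul_left (L⁻¹ * L⁻¹))) (fun n => ?_) (Eventually.of_forall fun N n => ?_)
  · have a1 := hrt (fun N : ℕ => (N : ℤ) + n) (tendsto_atTop_add_const_right _ _ tendsto_natCast_atTop_atTop)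
    have a2 := hrt (fun N : ℕ => (N : ℤ) - n) (tendsto_atTop_add_const_right _ _ tendsto_natCast_atTop_atTop)
    have a3 : Tendsto (fun N : ℕ => pP x (2 * N)) atTop (𝓝 L) :=
      hlim.comp (tendsto_id.const_mul_atTop' two_pos)
    have a4 := (hlim.mul (((a3.mul a1).mul a2).mul_const (x ^ tT n)))
    rw [show L * (L * L⁻¹ * L⁻¹ * x ^ tT n) = x ^ tT n by field_simp] at a4
    have a5 := ((Complex.continuous_ofReal.tendsto _).comp a4).mul_const (z ^ n)
    push_cast at a5
    refine a5.congr fun N => ?_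
    simp [cC, mul_assoc]
  · have q1 := pP_pos h0 h1 N
    have q2 := pP_pos h0 h1 (2 * N)
    have q3 := pP_le_one h0 h1 N
    have q4 := pP_le_one h0 h1 (2 * N)
    have q5 := rR_nonneg h0 h1 (N + n)
    have q6 := rR_nonneg h0 h1 (N - n)
    have q7 : 0 ≤ cC x N n := by unfold cC; positivity
    rw [norm_mul, norm_mul, Complex.norm_real, Complex.norm_real, Real.norm_of_nonneg q1.le,
      Real.norm_of_nonneg q7, norm_zpow, cC]
    calc _ = (pP x N * pP x (2 * N)) * (rR x (N + n) * rR x (N - n)) * (x ^ tT n * ‖z‖ ^ n) := by ring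
      _ ≤ (1 * 1) * (L⁻¹ * L⁻¹) * (x ^ tT n * ‖z‖ ^ n) := by
        gcongr
        · exact hr _
        · exact hr _
      _ = _ := by ring

def aA (x : ℝ) (z : ℂ) : ℂ := ∏' n : ℕ, (1 + (x : ℂ) ^ (n + 1) * z)

lemma aA_summable {x : ℝ} (h0 : 0 < x) (h1 : x < 1) (z : ℂ) :
    Summable fun n : ℕ => ‖(x : ℂ) ^ (n + 1) * z‖ := by
  have := (pow_summable h0 h1).mul_right ‖z‖
  refine this.congr fun n => ?_
  rw [norm_mul, norm_pow, Complex.norm_real, Real.norm_of_nonneg h0.le]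

lemma aA_mult {x : ℝ} (h0 : 0 < x) (h1 : x < 1) (z : ℂ) :
    Multipliable fun n : ℕ => (1 + (x : ℂ) ^ (n + 1) * z) :=
  multipliable_one_add_of_summable (aA_summable h0 h1 z)

lemma aA_ne {x : ℝ} (h0 : 0 < x) (h1 : x < 1) (z : ℂ) (h : ∀ n : ℕ, 1 + (x : ℂ) ^ (n + 1) * z ≠ 0) :
    aA x z ≠ 0 := tprod_one_add_ne_zero_of_summable h (aA_summable h0 h1 z)

lemma aA_diff {x : ℝ} (h0 : 0 < x) (h1 : x < 1) : Continuous (aA x) := by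
  rw [continuous_iff_continuousAt]
  intro z
  have hK : IsOpen (Metric.ball (0 : ℂ) (‖z‖ + 1)) := Metric.isOpen_ball
  have H := Summable.hasProdLocallyUniformlyOn_nat_one_add (f := fun (n : ℕ) (z : ℂ) => (x : ℂ) ^ (n + 1) * z)
    hK ((pow_summable h0 h1).mul_right (‖z‖ + 1)) (Eventually.of_forall fun n w hw => by
      rw [norm_mul, norm_pow, Complex.norm_real, Real.norm_of_nonneg h0.le]
      have : ‖w‖ < ‖z‖ + 1 := by simpa using hw
      gcongr) (fun n => by fun_prop)
  have H2 := H.continuousOn (Frequently.of_forall fun s => by fun_prop)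
  exact H2.continuousAt (hK.mem_nhds (by simp))

lemma Theta_eq (q : ℝ) (z : ℂ) : Theta q z = ∑' n : ℤ, ((q⁻¹ : ℝ) : ℂ) ^ tT n * z ^ n := by
  unfold Theta tT
  refine tsum_congr fun n => ?_
  rw [Complex.ofReal_inv, inv_zpow, zpow_neg]

lemma Theta_shift {q : ℝ} (hq : 1 < q) (z : ℂ) (hz : z ≠ 0) : Theta q (q * z) = z * Theta q z := by
  have hq0 : (q : ℂ) ≠ 0 := by exact_mod_cast (by linarith : (0:ℝ) < q).ne'
  rw [Theta_eq, Theta_eq, ← tsum_mul_left, ← (Equiv.addRight (1 : ℤ)).tsum_eq]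
  refine tsum_congr fun n => ?_
  simp only [Equiv.coe_addRight]
  rw [tT_succ, Complex.ofReal_inv, zpow_add₀ (inv_ne_zero hq0), inv_zpow _ (n + 1), mul_zpow,
    zpow_add_one₀ hz]
  have := zpow_ne_zero (n + 1) hq0
  field_simp

lemma tri_eq {x : ℝ} (h0 : 0 < x) (h1 : x < 1) (z : ℂ) (hz : z ≠ 0) :
    HasProd (fun n : ℕ => (1 + (x : ℂ) ^ (n + 1) * (-1)) * (1 + (x : ℂ) ^ (n + 1) * z) *
      (1 + (x : ℂ) ^ n * z⁻¹)) (aA x (-1) * aA x z * ((1 + z⁻¹) * aA x z⁻¹)) := by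
  have m := aA_mult h0 h1 z⁻¹
  have h := HasProd.zero_mul (f := fun n : ℕ => 1 + (x : ℂ) ^ n * z⁻¹) m.hasProd
  simp only [pow_zero, one_mul] at h
  exact ((aA_mult h0 h1 (-1)).hasProd.mul (aA_mult h0 h1 z).hasProd).mul h

lemma Theta_prod {q : ℝ} (hq : 1 < q) (z : ℂ) (hz : z ≠ 0) :
    Theta q z = aA q⁻¹ (-1) * aA q⁻¹ z * ((1 + z⁻¹) * aA q⁻¹ z⁻¹) := by
  have h0 : 0 < q⁻¹ := by positivity
  have h1 : q⁻¹ < 1 := inv_lt_one_of_one_lt₀ hq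
  rw [Theta_eq]
  refine tendsto_nhds_unique (finite_tendsto h0 h1 z hz) ?_
  refine (tri_eq h0 h1 z hz).tendsto_prod_nat.congr fun N => ?_
  rw [fF, pP]
  push_cast
  rw [← Finset.prod_mul_distrib]
  refine Finset.prod_congr rfl fun k _ => ?_
  ring

def sS (q : ℝ) (z : ℂ) : Prop := Theta q z = 0 ∧ ∃ d, d ≠ 0 ∧ HasDerivAt (Theta q) d z

lemma sS_base {q : ℝ} (hq : 1 < q) : sS q (-1) := by
  have h0 : 0 < q⁻¹ := by positivity
  have h1 : q⁻¹ < 1 := inv_lt_one_of_one_lt₀ hq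
  have hz : Theta q (-1) = 0 := by
    rw [Theta_prod hq _ (by norm_num)]; norm_num
  have hA : aA q⁻¹ (-1) ≠ 0 := by
    refine aA_ne h0 h1 _ fun n => ?_
    have := (fac_pos h0 h1 n).ne'
    rw [mul_neg_one, ← sub_eq_add_neg]
    exact_mod_cast this
  refine ⟨hz, -(aA q⁻¹ (-1) * aA q⁻¹ (-1) * aA q⁻¹ (-1)), by simpa using hA, ?_⟩
  rw [hasDerivAt_iff_tendsto_slope]
  have c : ContinuousAt (fun z : ℂ => aA q⁻¹ (-1) * aA q⁻¹ z * (z⁻¹ * aA q⁻¹ z⁻¹)) (-1) := by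
    have c0 : ContinuousAt (fun z : ℂ => z⁻¹) (-1) := continuousAt_inv₀ (by norm_num)
    have cA := aA_diff h0 h1
    exact (continuousAt_const.mul cA.continuousAt).mul (c0.mul (cA.continuousAt.comp c0))
  have c1 := c.tendsto.mono_left (nhdsWithin_le_nhds (s := {-1}ᶜ))
  rw [show (-1 : ℂ)⁻¹ = -1 by norm_num] at c1
  rw [show -(aA q⁻¹ (-1) * aA q⁻¹ (-1) * aA q⁻¹ (-1)) = aA q⁻¹ (-1) * aA q⁻¹ (-1) * (-1 * aA q⁻¹ (-1)) by ring]
  refine c1.congr' ?_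
  have hne : ∀ᶠ z : ℂ in 𝓝[≠] (-1), z ≠ 0 :=
    nhdsWithin_le_nhds (isOpen_ne.mem_nhds (by norm_num))
  filter_upwards [hne, self_mem_nhdsWithin] with z hz0 hz1
  have hz1 : z ≠ -1 := hz1
  have : z + 1 ≠ 0 := fun h => hz1 (eq_neg_of_add_eq_zero_left h)
  rw [slope_def_field, hz, Theta_prod hq z hz0, sub_neg_eq_add]
  field_simp
  ring

lemma sS_up {q : ℝ} (hq : 1 < q) {z : ℂ} (hz : z ≠ 0) (h : sS q z) : sS q (q * z) := by
  have hq0 : (q : ℂ) ≠ 0 := by exact_mod_cast (by linarith : (0:ℝ) < q).ne'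
  obtain ⟨h0, d, hd, H⟩ := h
  refine ⟨by rw [Theta_shift hq z hz, h0, mul_zero], z * (d * (q : ℂ)⁻¹), by positivity, ?_⟩
  have e : (q : ℂ)⁻¹ * (q * z) = z := by field_simp
  have k1 : HasDerivAt (fun w : ℂ => (q : ℂ)⁻¹ * w) (q : ℂ)⁻¹ (q * z) := by
    simpa using (hasDerivAt_id ((q : ℂ) * z)).const_mul (q : ℂ)⁻¹
  have H' : HasDerivAt (Theta q) d ((q : ℂ)⁻¹ * (q * z)) := by rwa [e]
  have k2 := k1.mul (H'.comp (q * z) k1)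
  have k3 : HasDerivAt (Theta q) _ (q * z) := k2.congr_of_eventuallyEq (by
    filter_upwards [isOpen_ne.mem_nhds (mul_ne_zero hq0 hz)] with w hw
    have := Theta_shift hq ((q : ℂ)⁻¹ * w) (mul_ne_zero (inv_ne_zero hq0) hw)
    rw [mul_inv_cancel_left₀ hq0] at this
    simpa using this)
  convert k3 using 1
  simp [e, h0]

lemma sS_down {q : ℝ} (hq : 1 < q) {z : ℂ} (hz : z ≠ 0) (h : sS q (q * z)) : sS q z := by
  have hq0 : (q : ℂ) ≠ 0 := by exact_mod_cast (by linarith : (0:ℝ) < q).ne'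
  obtain ⟨h0, d, hd, H⟩ := h
  have h0' : Theta q z = 0 := by
    rw [Theta_shift hq z hz] at h0
    exact (mul_eq_zero.mp h0).resolve_left hz
  refine ⟨h0', z⁻¹ * (d * (q : ℂ)), by positivity, ?_⟩
  have k1 : HasDerivAt (fun w : ℂ => (q : ℂ) * w) (q : ℂ) z := by
    simpa using (hasDerivAt_id z).const_mul (q : ℂ)
  have k2 := (hasDerivAt_inv hz).mul (H.comp z k1)
  have k3 : HasDerivAt (Theta q) _ z := k2.congr_of_eventuallyEq (by
    filter_upwards [isOpen_ne.mem_nhds hz] with w hw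
    have hw : w ≠ 0 := hw
    simp [Theta_shift hq w hw, hw])
  convert k3 using 1
  simp [h0]

lemma sS_all {q : ℝ} (hq : 1 < q) (m : ℤ) : sS q (-(q : ℂ) ^ m) := by
  have hq0 : (q : ℂ) ≠ 0 := by exact_mod_cast (by linarith : (0:ℝ) < q).ne'
  induction m using Int.induction_on with
  | zero => simpa using sS_base hq
  | succ i ih =>
    have := sS_up hq (neg_ne_zero.mpr (zpow_ne_zero _ hq0)) ih
    rwa [mul_neg, ← zpow_one_add₀ hq0, add_comm] at this
  | pred i ih =>
    refine sS_down hq (neg_ne_zero.mpr (zpow_ne_zero _ hq0)) ?_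
    rwa [mul_neg, ← zpow_one_add₀ hq0, add_sub_cancel]

lemma Theta_zero {q : ℝ} (hq : 1 < q) {z : ℂ} (hz : z ≠ 0) (h : Theta q z = 0) :
    ∃ m : ℤ, z = -(q : ℂ) ^ m := by
  have hq0 : (q : ℂ) ≠ 0 := by exact_mod_cast (by linarith : (0:ℝ) < q).ne'
  have h0 : 0 < q⁻¹ := by positivity
  have h1 : q⁻¹ < 1 := inv_lt_one_of_one_lt₀ hq
  by_contra! hc
  have key : ∀ n : ℤ, 1 + (q : ℂ) ^ n * z ≠ 0 := fun n hn => by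
    apply hc (-n)
    have := zpow_ne_zero n hq0
    rw [zpow_neg]
    field_simp
    linear_combination hn
  refine absurd h ?_
  rw [Theta_prod hq z hz]
  have a1 : aA q⁻¹ (-1) ≠ 0 := by
    refine aA_ne h0 h1 _ fun n => ?_
    have := (fac_pos h0 h1 n).ne'
    rw [mul_neg_one, ← sub_eq_add_neg]
    exact_mod_cast this
  have a2 : aA q⁻¹ z ≠ 0 := by
    refine aA_ne h0 h1 _ fun n => ?_
    have := key (-((n + 1 : ℕ) : ℤ))
    rwa [zpow_neg, zpow_natCast, ← inv_pow, ← Complex.ofReal_inv] at this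
  have a3 : aA q⁻¹ z⁻¹ ≠ 0 := by
    refine aA_ne h0 h1 _ fun n hn => ?_
    have := key ((n + 1 : ℕ) : ℤ)
    rw [zpow_natCast] at this
    apply this
    have h5 := pow_ne_zero (n + 1) hq0
    rw [Complex.ofReal_inv, inv_pow] at hn
    field_simp at hn
    linear_combination hn
  have a4 : 1 + z⁻¹ ≠ 0 := fun hn => by
    apply key 0
    field_simp at hn
    rw [zpow_zero]
    linear_combination hn
  exact mul_ne_zero (mul_ne_zero a1 a2) (mul_ne_zero a4 a3)

/-- The Jacobi triple product identity:
`Θ_q(z) = ∏_{n≥0} (1 − q^{−n−1})(1 + q^{−n−1} z)(1 + q^{−n} z^{−1})` for all `z ∈ ℂ*`;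
consequently `Θ_q` vanishes exactly on the discrete q-spiral `−q^ℤ`, with simple zeros. -/
theorem theta_triple_product (q : ℝ) (hq : 1 < q) :
    (∀ z : ℂ, z ≠ 0 →
      Theta q z = ∏' n : ℕ,
        ((1 - (q : ℂ) ^ (-(n : ℤ) - 1)) * (1 + (q : ℂ) ^ (-(n : ℤ) - 1) * z) *
          (1 + (q : ℂ) ^ (-(n : ℤ)) * z⁻¹))) ∧
    ({z : ℂ | z ≠ 0 ∧ Theta q z = 0} = {z : ℂ | ∃ m : ℤ, z = -(q : ℂ) ^ m}) ∧
    (∀ z : ℂ, z ≠ 0 → Theta q z = 0 → deriv (Theta q) z ≠ 0) := by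
  have hq0 : (q : ℂ) ≠ 0 := by exact_mod_cast (by linarith : (0:ℝ) < q).ne'
  have h0 : 0 < q⁻¹ := by positivity
  have h1 : q⁻¹ < 1 := inv_lt_one_of_one_lt₀ hq
  refine ⟨fun z hz => ?_, ?_, fun z hz h => ?_⟩
  · rw [Theta_prod hq z hz, ← (tri_eq h0 h1 z hz).tprod_eq]
    refine tprod_congr fun n => ?_
    have e1 : (q : ℂ) ^ (-(n : ℤ)) = ((q⁻¹ : ℝ) : ℂ) ^ n := by
      rw [zpow_neg, zpow_natCast, ← inv_pow, ← Complex.ofReal_inv]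
    have e2 : (q : ℂ) ^ (-(n : ℤ) - 1) = ((q⁻¹ : ℝ) : ℂ) ^ (n + 1) := by
      rw [zpow_sub_one₀ hq0, e1, pow_succ, ← Complex.ofReal_inv]
    rw [e1, e2]
    ring
  · ext z
    constructor
    · rintro ⟨hz, h⟩
      exact Theta_zero hq hz h
    · rintro ⟨m, rfl⟩
      exact ⟨neg_ne_zero.mpr (zpow_ne_zero _ hq0), (sS_all hq m).1⟩
  · obtain ⟨m, rfl⟩ := Theta_zero hq hz h
    obtain ⟨_, d, hd, H⟩ := sS_all hq m
    rwa [H.deriv]
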